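/- There exists an absolute constant C ≥ 1 such that for every integer d ≥ 2 and every ε ∈ (0, 1/2] with ε ≥ exp(-d), one has Ñ(ε, d) ≤ C · d · ln d / ε. -/

import Mathlib

open MeasureTheory Set

noncomputable section

/-- The unit cube `Q_d = [0,1]^d`. -/
def cube (d : ℕ) : Set (Fin d → ℝ) := Set.univ.pi fun _ => Set.Icc (0 : ℝ) 1

/-- The periodic interval `I(s,t)`: `(s,t)` if `s < t`, and `[0,1] \ [t,s]` if `t < s`. -/
def perInterval (s t : ℝ) : Set ℝ :=
  if s < t then Set.Ioo s t else Set.Icc 0 1 \ Set.Icc t s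

/-- `B` is a periodic axis-parallel box in the unit cube. -/
def IsPerBox {d : ℕ} (B : Set (Fin d → ℝ)) : Prop :=
  ∃ a b : Fin d → ℝ, a ∈ cube d ∧ b ∈ cube d ∧ (∀ i, a i ≠ b i) ∧
    B = Set.univ.pi fun i => perInterval (a i) (b i)

/-- Periodic dispersion of a point set `P ⊆ Q_d`. -/
def pdisp {d : ℕ} (P : Set (Fin d → ℝ)) : ℝ :=
  sSup {v : ℝ | ∃ B : Set (Fin d → ℝ), IsPerBox B ∧ B ∩ P = ∅ ∧ v = (volume B).toReal}

/-- Minimal periodic dispersion `disp̃*(n,d)`. -/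
def pminDisp (n d : ℕ) : ℝ :=
  sInf {v : ℝ | ∃ P : Finset (Fin d → ℝ),
    ↑P ⊆ cube d ∧ P.card = n ∧ v = pdisp (↑P : Set (Fin d → ℝ))}

/-- Inverse of the minimal periodic dispersion, `Ñ(ε,d)`. -/
def pNinv (ε : ℝ) (d : ℕ) : ℕ := sInf {n : ℕ | pminDisp n d ≤ ε}


theorem greedy_aux {X ι : Type*} [MeasurableSpace X] (μ : Measure X) (K : Set X)
    (hK : μ K = 1) (F : Finset ι) (w : ι → ℝ) (hw : ∀ i, 0 ≤ w i) (S : ι → Set X)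
    (hm : ∀ i, MeasurableSet (S i)) (hKm : MeasurableSet K)
    (v : ℝ) (hv1 : v ≤ 1) (hS : ∀ i ∈ F, v ≤ μ.real (S i ∩ K)) :
    ∃ x ∈ K, (by classical exact ∑ i ∈ F.filter (fun i => x ∉ S i), w i) ≤ (1 - v) * ∑ i ∈ F, w i := by
  classical
  set f : X → ℝ := fun x => ∑ i ∈ F, (S i).indicator (fun _ => w i) x with hf
  have hint : ∀ i ∈ F, IntegrableOn ((S i).indicator (fun _ => w i)) K μ := by
    intro i _
    apply Integrable.indicator _ (hm i)
    exact integrableOn_const (by rw [hK]; simp)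
  have hfi : IntegrableOn f K μ := integrable_finset_sum F hint
  obtain ⟨x, hxK, hx⟩ := exists_setAverage_le (by rw [hK]; simp) (by rw [hK]; simp) hfi
  refine ⟨x, hxK, ?_⟩
  have h1 : ⨍ a in K, f a ∂μ = ∑ i ∈ F, μ.real (S i ∩ K) * w i := by
    rw [setAverage_eq, measureReal_def, hK]
    simp only [ENNReal.toReal_one, inv_one, one_smul]
    rw [hf, integral_finset_sum F hint]
    refine Finset.sum_congr rfl fun i _ => ?_
    rw [integral_indicator (hm i)]
    simp [measureReal_def, Measure.restrict_apply (hm i)]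
  have h2 : v * ∑ i ∈ F, w i ≤ ∑ i ∈ F, μ.real (S i ∩ K) * w i := by
    rw [Finset.mul_sum]
    exact Finset.sum_le_sum fun i hi => mul_le_mul_of_nonneg_right (hS i hi) (hw i)
  have h3 : f x = ∑ i ∈ F.filter (fun i => x ∈ S i), w i := by
    rw [hf, Finset.sum_filter]
    refine Finset.sum_congr rfl fun i _ => ?_
    simp [Set.indicator_apply]
  have h4 := Finset.sum_filter_add_sum_filter_not F (fun i => x ∈ S i) w
  rw [h1] at hx
  rw [h3] at hx
  linarith

open Classical in
theorem greedy {X ι : Type*} [MeasurableSpace X] (μ : Measure X) (K : Set X)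
    (hK : μ K = 1) (F : Finset ι) (w : ι → ℝ) (hw : ∀ i, 0 ≤ w i) (S : ι → Set X)
    (hm : ∀ i, MeasurableSet (S i)) (hKm : MeasurableSet K)
    (v : ℝ) (hv1 : v ≤ 1) (hS : ∀ i ∈ F, v ≤ μ.real (S i ∩ K)) (n : ℕ) :
    ∃ P : Finset X, P.card ≤ n ∧ (↑P ⊆ K) ∧
      ∑ i ∈ F.filter (fun i => ∀ x ∈ P, x ∉ S i), w i ≤ (1 - v) ^ n * ∑ i ∈ F, w i := by
  induction n with
  | zero => exact ⟨∅, by simp⟩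
  | succ n ih =>
    obtain ⟨P, hP, hPK, hs⟩ := ih
    obtain ⟨x, hxK, hx⟩ := greedy_aux μ K hK (F.filter (fun i => ∀ x ∈ P, x ∉ S i)) w hw S hm hKm v
      hv1 (fun i hi => hS i (Finset.mem_filter.1 hi).1)
    refine ⟨insert x P, (Finset.card_insert_le _ _).trans (by omega), ?_, ?_⟩
    · rw [Finset.coe_insert]
      exact Set.insert_subset hxK hPK
    · have : F.filter (fun i => ∀ y ∈ insert x P, y ∉ S i) =
          (F.filter (fun i => ∀ x ∈ P, x ∉ S i)).filter (fun i => x ∉ S i) := by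
        ext i
        simp only [Finset.mem_filter, Finset.mem_insert, forall_eq_or_imp]
        tauto
      rw [this]
      refine hx.trans ?_
      rw [pow_succ, mul_comm ((1 - v) ^ n), mul_assoc]
      exact mul_le_mul_of_nonneg_left hs (by linarith)

def perLen (s t : ℝ) : ℝ := if s < t then t - s else 1 - (s - t)

theorem perInterval_meas (s t : ℝ) : MeasurableSet (perInterval s t) := by
  unfold perInterval
  split_ifs
  · exact measurableSet_Ioo
  · exact measurableSet_Icc.diff measurableSet_Icc

theorem perInterval_sub {s t : ℝ} (hs : s ∈ Set.Icc (0:ℝ) 1) (ht : t ∈ Set.Icc (0:ℝ) 1) :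
    perInterval s t ⊆ Set.Icc 0 1 := by
  unfold perInterval
  split_ifs
  · exact fun x hx => ⟨hs.1.trans hx.1.le, hx.2.le.trans ht.2⟩
  · exact Set.diff_subset

theorem perLen_nonneg {s t : ℝ} (hs : s ∈ Set.Icc (0:ℝ) 1) (ht : t ∈ Set.Icc (0:ℝ) 1) :
    0 ≤ perLen s t := by
  have := hs.1; have := hs.2; have := ht.1; have := ht.2
  unfold perLen
  split_ifs <;> linarith

theorem perLen_le_one {s t : ℝ} (hs : s ∈ Set.Icc (0:ℝ) 1) (ht : t ∈ Set.Icc (0:ℝ) 1) :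
    perLen s t ≤ 1 := by
  have := hs.1; have := hs.2; have := ht.1; have := ht.2
  unfold perLen
  split_ifs <;> linarith

theorem perInterval_vol {s t : ℝ} (hs : s ∈ Set.Icc (0:ℝ) 1) (ht : t ∈ Set.Icc (0:ℝ) 1) :
    (volume (perInterval s t)).toReal = perLen s t := by
  unfold perInterval perLen
  split_ifs with h
  · rw [Real.volume_Ioo, ENNReal.toReal_ofReal (by linarith)]
  · push Not at h
    have hsub : Set.Icc t s ⊆ Set.Icc 0 1 := Set.Icc_subset_Icc ht.1 hs.2
    have := measureReal_diff (μ := volume) hsub measurableSet_Icc (by simp)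
    rw [measureReal_def] at this
    rw [this]
    simp [measureReal_def, h]

theorem box_vol {d : ℕ} {a b : Fin d → ℝ} (ha : a ∈ cube d) (hb : b ∈ cube d) :
    (volume (Set.univ.pi fun i => perInterval (a i) (b i))).toReal = ∏ i, perLen (a i) (b i) := by
  rw [volume_pi_pi, ENNReal.toReal_prod]
  exact Finset.prod_congr rfl fun i _ => perInterval_vol (ha i trivial) (hb i trivial)

theorem coord {s t : ℝ} (hs : s ∈ Set.Icc (0:ℝ) 1) (ht : t ∈ Set.Icc (0:ℝ) 1) (hst : s ≠ t)
    (hl : 0 < perLen s t) (d : ℕ) (hd : 1 ≤ d) :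
    ∃ m a b : ℕ, 1 ≤ m ∧ m * perLen s t ≤ 1 ∧ a ≤ 8 * d * m ∧ b ≤ 8 * d * m ∧
      perInterval ((a:ℝ) / (8 * d * m : ℕ)) ((b:ℝ) / (8 * d * m : ℕ)) ⊆ perInterval s t ∧
      perLen s t * (1 - 1 / (2 * d)) ≤
        perLen ((a:ℝ) / (8 * d * m : ℕ)) ((b:ℝ) / (8 * d * m : ℕ)) := by
  have hl1 := perLen_le_one hs ht
  set l := perLen s t with hldef
  set m := ⌊1 / l⌋₊ with hm
  have h1l : 1 ≤ 1 / l := by rw [le_div_iff₀ hl]; linarith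
  have hm1 : 1 ≤ m := Nat.le_floor (by exact_mod_cast h1l)
  have hml : (m:ℝ) ≤ 1 / l := Nat.floor_le (by positivity)
  have hml2 : 1 / l < m + 1 := Nat.lt_floor_add_one _
  have hm1' : (1:ℝ) ≤ m := by exact_mod_cast hm1
  have hd' : (1:ℝ) ≤ d := by exact_mod_cast hd
  rw [le_div_iff₀ hl] at hml
  rw [div_lt_iff₀ hl] at hml2
  have hml3 : 1 ≤ 2 * m * l := by nlinarith
  set N := 8 * d * m with hN
  have hNr : (N:ℝ) = 8 * d * m := by rw [hN]; push_cast; ring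
  have hNpos : (0:ℝ) < N := by rw [hNr]; positivity
  have hNl : 4 * d ≤ N * l := by rw [hNr]; nlinarith
  have h2N : 2 / (N:ℝ) ≤ l / (2 * d) := by
    rw [div_le_div_iff₀ hNpos (by positivity)]; linarith
  have hl2 : l / (2 * d) ≤ l / 2 := by
    apply div_le_div_of_nonneg_left hl.le (by norm_num); linarith
  have ha1 : s * N ≤ ⌈s * N⌉₊ := Nat.le_ceil _
  have ha2 : (⌈s * N⌉₊ : ℝ) < s * N + 1 := Nat.ceil_lt_add_one (mul_nonneg hs.1 hNpos.le)
  have hb1 : (⌊t * N⌋₊ : ℝ) ≤ t * N := Nat.floor_le (mul_nonneg ht.1 hNpos.le)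
  have hb2 : t * N < ⌊t * N⌋₊ + 1 := Nat.lt_floor_add_one _
  have haN : ⌈s * N⌉₊ ≤ N := Nat.ceil_le.2 (by nlinarith [hs.2])
  have hbN : ⌊t * N⌋₊ ≤ N := by
    have : (⌊t * N⌋₊ : ℝ) ≤ N := hb1.trans (by nlinarith [ht.2])
    exact_mod_cast this
  refine ⟨m, ⌈s * N⌉₊, ⌊t * N⌋₊, hm1, hml, haN, hbN, ?_⟩
  rw [← hN]
  have hA1 : s ≤ (⌈s * N⌉₊ : ℝ) / N := by rwa [le_div_iff₀ hNpos]
  have hA2 : (⌈s * N⌉₊ : ℝ) / N ≤ s + 1 / N := by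
    rw [div_le_iff₀ hNpos, add_mul, div_mul_cancel₀ _ hNpos.ne']; exact ha2.le
  have hB1 : (⌊t * N⌋₊ : ℝ) / N ≤ t := by rwa [div_le_iff₀ hNpos]
  have hB2 : t - 1 / N ≤ (⌊t * N⌋₊ : ℝ) / N := by
    rw [le_div_iff₀ hNpos, sub_mul, div_mul_cancel₀ _ hNpos.ne']; linarith
  generalize (⌈s * N⌉₊ : ℝ) / N = A at *
  generalize (⌊t * N⌋₊ : ℝ) / N = B at *
  have e2 : 2 / (N:ℝ) = 1 / N + 1 / N := by ring
  have e3 : l * (1 - 1 / (2 * d)) = l - l / (2 * d) := by ring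
  rw [e3]
  rcases lt_or_gt_of_ne hst with h | h
  · have hl' : l = t - s := by rw [hldef]; simp [perLen, h]
    have hAB : A < B := by linarith
    simp only [perInterval, perLen, h, hAB, if_true]
    exact ⟨Set.Ioo_subset_Ioo hA1 hB1, by linarith⟩
  · have hl' : l = 1 - (s - t) := by rw [hldef]; simp [perLen, h.le, not_lt]
    have hAB : ¬ A < B := by linarith
    simp only [perInterval, perLen, not_lt.2 h.le, hAB, if_false]
    exact ⟨Set.diff_subset_diff_right (Set.Icc_subset_Icc hB1 hA1), by linarith⟩

/-- index set in one coordinate -/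
def idx (d M : ℕ) : Finset (Σ _ : ℕ, ℕ × ℕ) :=
  (Finset.Icc 1 M).sigma fun m => Finset.range (8 * d * m + 1) ×ˢ Finset.range (8 * d * m + 1)

theorem sum_sq (M : ℕ) : ∑ m ∈ Finset.Icc 1 (M + 1), 1 / (m:ℝ) ^ 2 ≤ 2 - 1 / ((M:ℝ) + 1) := by
  induction M with
  | zero => norm_num
  | succ M ih =>
    rw [Finset.sum_Icc_succ_top (by omega)]
    have h0 : (0:ℝ) ≤ M := by positivity
    have : 1 / ((M + 1 + 1 : ℕ):ℝ) ^ 2 ≤ 1 / ((M:ℝ) + 1) - 1 / (((M + 1 : ℕ):ℝ) + 1) := by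
      push_cast
      rw [div_sub_div _ _ (by positivity) (by positivity), div_le_div_iff₀ (by positivity) (by positivity)]
      nlinarith
    linarith

theorem sum_sq_le (M : ℕ) : ∑ m ∈ Finset.Icc 1 M, 1 / (m:ℝ) ^ 2 ≤ (2:ℝ) := by
  have h := sum_sq M
  rw [Finset.sum_Icc_succ_top (by omega)] at h
  have h0 : (0:ℝ) ≤ 1 / ((M:ℝ) + 1) := by positivity
  have h1 : (0:ℝ) ≤ 1 / ((M + 1 : ℕ):ℝ) ^ 2 := by positivity
  linarith

theorem idx_sum (d M : ℕ) (hd : 1 ≤ d) :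
    ∑ p ∈ idx d M, 1 / (p.1:ℝ) ^ 4 ≤ 162 * (d:ℝ) ^ 2 := by
  unfold idx
  rw [Finset.sum_sigma]
  have h : ∀ m ∈ Finset.Icc 1 M, (∑ _s ∈ Finset.range (8 * d * m + 1) ×ˢ Finset.range (8 * d * m + 1),
      1 / (m:ℝ) ^ 4) ≤ 81 * d ^ 2 * (1 / (m:ℝ) ^ 2) := by
    intro m hm
    have hm1 : (1:ℝ) ≤ m := by exact_mod_cast (Finset.mem_Icc.1 hm).1
    have hd' : (1:ℝ) ≤ d := by exact_mod_cast hd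
    rw [Finset.sum_const, Finset.card_product, Finset.card_range, nsmul_eq_mul]
    push_cast
    have h1 : (8 * d * m + 1 : ℝ) ≤ 9 * d * m := by nlinarith
    have h2 : (8 * d * m + 1 : ℝ) * (8 * d * m + 1) ≤ (9 * d * m) * (9 * d * m) :=
      mul_le_mul h1 h1 (by positivity) (by positivity)
    calc _ ≤ ((9 * d * m) * (9 * d * m)) * (1 / (m:ℝ) ^ 4) :=
          mul_le_mul_of_nonneg_right h2 (by positivity)
      _ = _ := by field_simp; ring
  refine (Finset.sum_le_sum h).trans ?_
  rw [← Finset.mul_sum]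
  have := sum_sq_le M
  have : (81 * (d:ℝ) ^ 2) * ∑ m ∈ Finset.Icc 1 M, 1 / (m:ℝ) ^ 2 ≤ 81 * d ^ 2 * 2 :=
    mul_le_mul_of_nonneg_left (by linarith) (by positivity)
  linarith

theorem prod_m_le {d : ℕ} (m : Fin d → ℕ) (l : Fin d → ℝ) (ε : ℝ) (hε : 0 < ε)
    (h : ∀ i, m i * l i ≤ 1) (hl : ∀ i, 0 ≤ l i) (hp : ε ≤ ∏ i, l i) :
    (∏ i, (m i:ℝ)) * ε ≤ 1 := by
  calc (∏ i, (m i:ℝ)) * ε ≤ (∏ i, (m i:ℝ)) * ∏ i, l i :=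
        mul_le_mul_of_nonneg_left hp (by positivity)
    _ = ∏ i, (m i * l i) := by rw [Finset.prod_mul_distrib]
    _ ≤ 1 := Finset.prod_le_one (fun i _ => mul_nonneg (by positivity) (hl i)) fun i _ => h i

theorem cube_vol (d : ℕ) : volume (cube d) = 1 := by
  unfold cube
  rw [volume_pi_pi]; simp

/-- endpoints -/
def gA {d : ℕ} (p : Fin d → (Σ _ : ℕ, ℕ × ℕ)) : Fin d → ℝ :=
  fun i => ((p i).2.1 : ℝ) / (8 * d * (p i).1 : ℕ)

def gB {d : ℕ} (p : Fin d → (Σ _ : ℕ, ℕ × ℕ)) : Fin d → ℝ :=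
  fun i => ((p i).2.2 : ℝ) / (8 * d * (p i).1 : ℕ)

def gBox {d : ℕ} (p : Fin d → (Σ _ : ℕ, ℕ × ℕ)) : Set (Fin d → ℝ) :=
  Set.univ.pi fun i => perInterval (gA p i) (gB p i)

theorem exists_set (d : ℕ) (hd : 2 ≤ d) (ε : ℝ) (hε : 0 < ε) (hε1 : ε ≤ 1 / 2) (n : ℕ)
    (hn : (1 - ε / 2) ^ n * (162 * d ^ 2) ^ d < ε ^ 4) :
    ∃ P : Finset (Fin d → ℝ), P.card ≤ n ∧ ↑P ⊆ cube d ∧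
      ∀ B : Set (Fin d → ℝ), IsPerBox B → B ∩ ↑P = ∅ → (volume B).toReal ≤ ε := by
  classical
  set M := ⌊1 / ε⌋₊ with hM
  set F0 : Finset (Fin d → (Σ _ : ℕ, ℕ × ℕ)) := Fintype.piFinset fun _ => idx d M with hF0
  set w : (Fin d → (Σ _ : ℕ, ℕ × ℕ)) → ℝ := fun p => ∏ i, 1 / ((p i).1:ℝ) ^ 4 with hwdef
  have hw : ∀ p, 0 ≤ w p := fun p => Finset.prod_nonneg fun i _ => by positivity
  have hsum0 : ∑ p ∈ F0, w p ≤ (162 * d ^ 2) ^ d := by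
    rw [hF0, hwdef, ← Finset.prod_univ_sum (fun _ : Fin d => idx d M) (fun _ p => 1 / (p.1:ℝ) ^ 4)]
    rw [Finset.prod_const, Finset.card_univ, Fintype.card_fin]
    exact pow_le_pow_left₀ (Finset.sum_nonneg fun _ _ => by positivity) (idx_sum d M (by omega)) d
  set F := F0.filter (fun p => ε / 2 ≤ volume.real (gBox p ∩ cube d)) with hF
  have hsum : ∑ p ∈ F, w p ≤ (162 * d ^ 2) ^ d :=
    (Finset.sum_le_sum_of_subset_of_nonneg (Finset.filter_subset _ _) fun i _ _ => hw i).trans hsum0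
  obtain ⟨P, hPn, hPc, hPs⟩ := greedy volume (cube d) (cube_vol d) F w hw gBox
    (fun p => MeasurableSet.univ_pi fun i => perInterval_meas _ _)
    (MeasurableSet.univ_pi fun i => measurableSet_Icc) (ε / 2) (by linarith)
    (fun i hi => (Finset.mem_filter.1 hi).2) n
  refine ⟨P, hPn, hPc, ?_⟩
  rintro B ⟨a, b, ha, hb, hab, rfl⟩ hdis
  by_contra hvol
  push Not at hvol
  rw [box_vol ha hb] at hvol
  have hl0 : ∀ i, 0 ≤ perLen (a i) (b i) := fun i => perLen_nonneg (ha i trivial) (hb i trivial)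
  have hl : ∀ i, 0 < perLen (a i) (b i) := by
    intro i
    refine lt_of_le_of_ne (hl0 i) fun h => ?_
    rw [Finset.prod_eq_zero (Finset.mem_univ i) h.symm] at hvol
    linarith
  choose m A B' hm1 hml hA hB hsub hlen using fun i =>
    coord (ha i trivial) (hb i trivial) (hab i) (hl i) d (by omega)
  have hprod := prod_m_le m _ ε hε hml hl0 hvol.le
  have hmpos : ∀ i, (0:ℝ) < m i := fun i => by exact_mod_cast hm1 i
  have hd' : (2:ℝ) ≤ d := by exact_mod_cast hd
  set p : Fin d → (Σ _ : ℕ, ℕ × ℕ) := fun i => ⟨m i, A i, B' i⟩ with hp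
  have hpF0 : p ∈ F0 := by
    rw [hF0, Fintype.mem_piFinset]
    intro i
    simp only [idx, hp, Finset.mem_sigma, Finset.mem_Icc, Finset.mem_product, Finset.mem_range]
    refine ⟨⟨hm1 i, ?_⟩, Nat.lt_succ_of_le (hA i), Nat.lt_succ_of_le (hB i)⟩
    have h1 : m i ≤ ∏ j, m j := Nat.le_of_dvd (Finset.prod_pos fun j _ => hm1 j)
      (Finset.dvd_prod_of_mem m (Finset.mem_univ i))
    refine h1.trans (Nat.le_floor ?_)
    rw [le_div_iff₀ hε]
    push_cast
    exact hprod
  have hN : ∀ i, (0:ℝ) < (8 * d * m i : ℕ) := fun i => by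
    have := hmpos i
    push_cast; positivity
  have hgA : gA p ∈ cube d := fun i _ => ⟨by unfold gA; positivity, by
    simp only [gA, hp]
    rw [div_le_one (hN i)]; exact_mod_cast hA i⟩
  have hgB : gB p ∈ cube d := fun i _ => ⟨by unfold gB; positivity, by
    simp only [gB, hp]
    rw [div_le_one (hN i)]; exact_mod_cast hB i⟩
  have hpF : p ∈ F := by
    rw [hF, Finset.mem_filter]
    refine ⟨hpF0, ?_⟩
    have hsubc : gBox p ⊆ cube d :=
      Set.pi_mono fun i _ => perInterval_sub (hgA i trivial) (hgB i trivial)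
    rw [Set.inter_eq_left.2 hsubc, measureReal_def, gBox, box_vol hgA hgB]
    have hbern : (1:ℝ) / 2 ≤ (1 - 1 / (2 * d)) ^ d := by
      have h := one_add_mul_le_pow (a := -(1 / (2 * (d:ℝ)))) (by
        have : 1 / (2 * (d:ℝ)) ≤ 1 := by rw [div_le_one (by positivity)]; linarith
        linarith) d
      have e : 1 + (d:ℝ) * -(1 / (2 * (d:ℝ))) = 1 / 2 := by field_simp; norm_num
      rw [e] at h
      rwa [sub_eq_add_neg]
    have h0 : 0 ≤ 1 - 1 / (2 * (d:ℝ)) := by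
      have : 1 / (2 * (d:ℝ)) ≤ 1 := by rw [div_le_one (by positivity)]; linarith
      linarith
    calc ε / 2 ≤ (∏ i, perLen (a i) (b i)) * (1 - 1 / (2 * d)) ^ d := by
          nlinarith
      _ = ∏ i, (perLen (a i) (b i) * (1 - 1 / (2 * d))) := by
          rw [Finset.prod_mul_distrib, Finset.prod_const, Finset.card_univ, Fintype.card_fin]
      _ ≤ ∏ i, perLen (gA p i) (gB p i) :=
          Finset.prod_le_prod (fun i _ => mul_nonneg (hl0 i) h0) fun i _ => hlen i
  have hmem : p ∈ F.filter (fun i => ∀ x ∈ P, x ∉ gBox i) := by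
    rw [Finset.mem_filter]
    refine ⟨hpF, fun x hx hxp => ?_⟩
    have : x ∈ (Set.univ.pi fun i => perInterval (a i) (b i)) ∩ (P : Set (Fin d → ℝ)) :=
      ⟨fun i _ => hsub i (hxp i trivial), hx⟩
    rw [hdis] at this
    exact this
  have h1 : w p ≤ _ := Finset.single_le_sum (fun i _ => hw i) hmem
  have h2 : ε ^ 4 ≤ w p := by
    have hpp : 0 < ∏ i, (m i : ℝ) := Finset.prod_pos fun i _ => hmpos i
    have e : w p = (1 / ∏ i, (m i : ℝ)) ^ 4 := by
      simp only [hwdef, hp, one_div, ← inv_pow, Finset.prod_pow, Finset.prod_inv_distrib]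
    rw [e]
    apply pow_le_pow_left₀ hε.le
    rw [le_div_iff₀ hpp]
    linarith
  have h3 : (1 - ε / 2) ^ n * ∑ i ∈ F, w i ≤ (1 - ε / 2) ^ n * (162 * d ^ 2) ^ d :=
    mul_le_mul_of_nonneg_left hsum (pow_nonneg (by linarith) n)
  linarith

theorem pNinv_le (d : ℕ) (ε : ℝ) (hε : 0 < ε) (n : ℕ) (P : Finset (Fin d → ℝ)) (h1 : P.card ≤ n)
    (h2 : ↑P ⊆ cube d)
    (h : ∀ B : Set (Fin d → ℝ), IsPerBox B → B ∩ ↑P = ∅ → (volume B).toReal ≤ ε) :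
    pNinv ε d ≤ n := by
  refine le_trans (Nat.sInf_le ?_) h1
  show pminDisp _ _ ≤ ε
  have hle : pdisp (↑P : Set (Fin d → ℝ)) ≤ ε := by
    apply Real.sSup_le _ hε.le
    rintro v ⟨B, hB, hd, rfl⟩
    exact h B hB hd
  refine le_trans (csInf_le ⟨0, ?_⟩ ⟨P, h2, rfl, rfl⟩) hle
  rintro v ⟨Q, _, _, rfl⟩
  apply Real.sSup_nonneg
  rintro v ⟨B, hB, hd, rfl⟩
  exact ENNReal.toReal_nonneg

/-- There exists an absolute constant `C ≥ 1` such that for every integer `d ≥ 2` and every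
`ε ∈ (0, 1/2]` with `ε ≥ exp(-d)`, one has `Ñ(ε,d) ≤ C d ln d / ε`. -/
theorem periodic_minimal_dispersion_inverse_bound_large_eps :
    ∃ C : ℝ, 1 ≤ C ∧ ∀ d : ℕ, 2 ≤ d → ∀ ε : ℝ, 0 < ε → ε ≤ 1 / 2 →
      Real.exp (-(d : ℝ)) ≤ ε →
      (pNinv ε d : ℝ) ≤ C * d * Real.log d / ε := by
  refine ⟨41, by norm_num, ?_⟩
  intro d hd ε hε hε1 hed
  have hd' : (2:ℝ) ≤ d := by exact_mod_cast hd
  set L := Real.log d with hL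
  have hL2 : 0.69 < L := by
    have : Real.log 2 ≤ L := Real.log_le_log (by norm_num) hd'
    have := Real.log_two_gt_d9
    linarith
  have hx1 : 1 ≤ d * L / ε := by
    rw [le_div_iff₀ hε]; nlinarith
  set n := ⌈40 * (d * L / ε)⌉₊ with hn
  have hn1 : 40 * (d * L / ε) ≤ n := Nat.le_ceil _
  have hn2 : (n:ℝ) < 40 * (d * L / ε) + 1 := Nat.ceil_lt_add_one (by linarith)
  have key : (1 - ε / 2) ^ n * (162 * (d:ℝ) ^ 2) ^ d < ε ^ 4 := by
    have a1 : (1 - ε / 2) ^ n ≤ Real.exp (-(20 * (d * L))) := by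
      have : 1 - ε / 2 ≤ Real.exp (-(ε / 2)) := by
        have := Real.add_one_le_exp (-(ε / 2)); linarith
      refine (pow_le_pow_left₀ (by linarith) this n).trans ?_
      rw [← Real.exp_nat_mul]
      apply Real.exp_le_exp.2
      have e : 40 * (d * L / ε) * (ε / 2) = 20 * (d * L) := by field_simp; norm_num
      have := mul_le_mul_of_nonneg_right hn1 (show 0 ≤ ε / 2 by linarith)
      linarith
    have a2 : (162 * (d:ℝ) ^ 2) ^ d ≤ Real.exp (d * (6 + 2 * L)) := by
      rw [Real.exp_nat_mul]
      apply pow_le_pow_left₀ (by positivity)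
      rw [Real.exp_add]
      have e1 : Real.exp (2 * L) = (d:ℝ) ^ 2 := by
        rw [show 2 * L = ((2:ℕ):ℝ) * L by norm_num, Real.exp_nat_mul, hL,
          Real.exp_log (by linarith)]
      have e2 : (162:ℝ) ≤ Real.exp 6 := by
        have h1 := Real.exp_one_gt_d9
        have : Real.exp 6 = Real.exp 1 ^ 6 := by rw [← Real.exp_nat_mul]; norm_num
        rw [this]
        calc (162:ℝ) ≤ 2.7 ^ 6 := by norm_num
          _ ≤ _ := pow_le_pow_left₀ (by norm_num) (by linarith) 6
      rw [e1]
      exact mul_le_mul_of_nonneg_right e2 (by positivity)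
    have a3 : Real.exp (-(4 * (d:ℝ))) ≤ ε ^ 4 := by
      have : Real.exp (-(4 * (d:ℝ))) = Real.exp (-(d:ℝ)) ^ 4 := by
        rw [← Real.exp_nat_mul]; congr 1; push_cast; ring
      rw [this]
      exact pow_le_pow_left₀ (Real.exp_pos _).le hed 4
    refine lt_of_lt_of_le ?_ a3
    refine (mul_le_mul a1 a2 (by positivity) (Real.exp_pos _).le).trans_lt ?_
    rw [← Real.exp_add]
    apply Real.exp_lt_exp.2
    nlinarith
  obtain ⟨P, h1, h2, h3⟩ := exists_set d hd ε hε hε1 n key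
  have := pNinv_le d ε hε n P h1 h2 h3
  have h4 : (pNinv ε d : ℝ) ≤ n := by exact_mod_cast this
  have e : 41 * (d:ℝ) * L / ε = 41 * (d * L / ε) := by ring
  rw [e]
  linarith
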